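/- arXiv:2201.03084 — 3 statements merged into one kernel-verified Lean document; each statement's English description precedes it below -/
import Mathlib

section
/- For every integer n ≥ 1, the moduli space 𝒳_n = F_n/PGL(2,ℂ) of complex rational functions of degree n, equipped with the quotient topology, is a Hausdorff topological space. -/
/-!
Setup: for `n ≥ 1`, a rational function of degree `n` on `ℂP¹` is represented by a
coprime pair `(a, b)` of binary forms of degree `n` in variables `x₀, x₁`.  A binary form
of degree `n` is encoded by its coefficient vector `Fin (n+1) → ℂ`, the form being
`∑ i, a i * x₀ ^ i * x₁ ^ (n - i)`; thus the pair space is the `(2n+2)`-dimensional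
complex vector space `(Fin (n+1) → ℂ) × (Fin (n+1) → ℂ)` with its standard (coefficient)
topology.  `F_n` is the space of classes `[a : b]` of coprime pairs up to simultaneous
scaling (a subspace of `ℂP^{2n+1}`, here constructed directly as the quotient of the
coprime pairs by scaling, with the quotient topology — which agrees with the subspace
topology since the projectivization map is open and the coprime locus is saturated).
`PGL(2,ℂ)` acts on `F_n` on the right by precomposition `[a : b] · g = [a ∘ g : b ∘ g]`,
`(a ∘ g)(x) = a (x g)`; since scalar matrices act trivially on `F_n`, the orbit space
`𝒳_n = F_n / PGL(2,ℂ)` coincides with the quotient of `F_n` by the (right) action of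
`GL(2,ℂ)` by substitution, which is how we construct it.  `𝒳_n` carries the quotient
topology and `pr : F_n → 𝒳_n` is the quotient map.
-/

open Filter Topology

noncomputable section

/-- Coefficient vector of a binary form of degree `n` in `x₀, x₁`. -/
abbrev Coeffs (n : ℕ) := Fin (n + 1) → ℂ

/-- Value of the binary form with coefficient vector `a` at the point `x = (x 0, x 1)`. -/
def evalForm {n : ℕ} (a : Coeffs n) (x : Fin 2 → ℂ) : ℂ :=
  ∑ i : Fin (n + 1), a i * x 0 ^ (i : ℕ) * x 1 ^ (n - (i : ℕ))

/-- Two binary forms of degree `n` are coprime iff they have no common zero in `ℂ² \ {0}`. -/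
def IsCoprimePair {n : ℕ} (a b : Coeffs n) : Prop :=
  ∀ x : Fin 2 → ℂ, x ≠ 0 → (evalForm a x ≠ 0 ∨ evalForm b x ≠ 0)

/-- The space of coprime pairs of binary forms of degree `n`
(a subspace of the `(2n+2)`-dimensional coefficient space). -/
abbrev RatRep (n : ℕ) := { v : Coeffs n × Coeffs n // IsCoprimePair v.1 v.2 }

/-- Simultaneous rescaling of a coprime pair. -/
def scaleRel (n : ℕ) (u v : RatRep n) : Prop := ∃ c : ℂˣ, v.val = c • u.val

/-- `F_n`: the space of rational functions `[a : b]` of degree `n`, i.e. coprime pairs of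
degree-`n` binary forms up to simultaneous scaling, with the quotient (= coefficient)
topology. -/
abbrev Fn (n : ℕ) := Quot (scaleRel n)

open MvPolynomial in
/-- The binary form (as a polynomial in `MvPolynomial (Fin 2) ℂ`) with coefficient
vector `a`. -/
def toPoly {n : ℕ} (a : Coeffs n) : MvPolynomial (Fin 2) ℂ :=
  ∑ i : Fin (n + 1), C (a i) * X 0 ^ (i : ℕ) * X 1 ^ (n - (i : ℕ))

/-- The coefficient vector of (the degree-`n` homogeneous part of) a polynomial in two
variables. -/
def ofPoly (n : ℕ) (p : MvPolynomial (Fin 2) ℂ) : Coeffs n :=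
  fun j => MvPolynomial.coeff (Finsupp.single 0 (j : ℕ) + Finsupp.single 1 (n - (j : ℕ))) p

/-- Right substitution action: the coefficient vector of `a ∘ g`, where
`(a ∘ g)(x) = a (x g)`, i.e. the substitution `xⱼ ↦ ∑ i, g i j * xᵢ`. -/
def compForm {n : ℕ} (a : Coeffs n) (g : Matrix (Fin 2) (Fin 2) ℂ) : Coeffs n :=
  ofPoly n (MvPolynomial.bind₁
    (fun j => ∑ i : Fin 2, MvPolynomial.C (g i j) * MvPolynomial.X i) (toPoly a))

/-- `p` and `q` in `F_n` are related iff `q = p · g` for some `g ∈ GL(2,ℂ)`; the orbits of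
this relation are exactly the orbits of the right `PGL(2,ℂ)`-action on `F_n`. -/
def glRel (n : ℕ) (p q : Fn n) : Prop :=
  ∃ (u v : RatRep n) (g : GL (Fin 2) ℂ),
    Quot.mk (scaleRel n) u = p ∧ Quot.mk (scaleRel n) v = q ∧
    v.val = (compForm u.val.1 g.val, compForm u.val.2 g.val)

/-- The moduli space `𝒳_n = F_n / PGL(2,ℂ)` with the quotient topology. -/
abbrev Xn (n : ℕ) := Quot (glRel n)

/-- The quotient map `pr : F_n → 𝒳_n`. -/
def pr (n : ℕ) : Fn n → Xn n := Quot.mk (glRel n)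

lemma eval_toPoly {n : ℕ} (a : Coeffs n) (x : Fin 2 → ℂ) :
    MvPolynomial.eval x (toPoly a) = evalForm a x := by
  simp [toPoly, evalForm]

lemma toPoly_isHomogeneous {n : ℕ} (a : Coeffs n) : (toPoly a).IsHomogeneous n := by
  refine MvPolynomial.IsHomogeneous.sum _ _ _ fun i _ => ?_
  have h := ((MvPolynomial.isHomogeneous_C_mul_X_pow (a i) (0 : Fin 2) (i : ℕ))).mul
    (MvPolynomial.isHomogeneous_X_pow (R := ℂ) (1 : Fin 2) (n - (i : ℕ)))
  rwa [Nat.add_sub_cancel' (Nat.lt_succ_iff.mp i.isLt)] at h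

lemma evalForm_ofPoly {n : ℕ} {p : MvPolynomial (Fin 2) ℂ} (hp : p.IsHomogeneous n)
    (x : Fin 2 → ℂ) : evalForm (ofPoly n p) x = MvPolynomial.eval x p := by
  rw [MvPolynomial.eval_eq']
  simp only [evalForm, ofPoly, Fin.prod_univ_two]
  symm
  have hdeg : ∀ d ∈ p.support, d 0 + d 1 = n := fun d hd => by
    have h := hp.degree_eq_sum_deg_support hd
    rw [h, ← Fin.sum_univ_two]
    exact (Finset.sum_subset (Finset.subset_univ _) fun j _ hj => Finsupp.notMem_support_iff.mp hj).symm
  have hmono : ∀ d ∈ p.support, (Finsupp.single 0 (d 0) + Finsupp.single 1 (n - d 0) :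
      Fin 2 →₀ ℕ) = d := fun d hd => by
    have h := hdeg d hd
    ext j
    fin_cases j
    · simp
    · simp; omega
  refine Finset.sum_of_injOn (fun d => Fin.ofNat (n + 1) (d 0)) ?_ ?_ ?_ ?_
  · intro d hd e he h
    have h' := congrArg Fin.val h
    have hd' := hdeg d hd
    have he' := hdeg e he
    simp only [Fin.val_ofNat] at h'
    rw [Nat.mod_eq_of_lt (by omega), Nat.mod_eq_of_lt (by omega)] at h'
    rw [← hmono d hd, ← hmono e he, h']
  · simp [Set.MapsTo]
  · intro i _ hi
    have : MvPolynomial.coeff (Finsupp.single 0 (i : ℕ) + Finsupp.single 1 (n - (i : ℕ))) p = 0 := by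
      by_contra hne
      refine hi ⟨_, Finset.mem_coe.mpr (MvPolynomial.mem_support_iff.mpr hne), ?_⟩
      ext
      simp
    rw [this]
    ring
  · intro d hd
    have hd' := hdeg d hd
    have hv : ((Fin.ofNat (n + 1) (d 0) : Fin (n + 1)) : ℕ) = d 0 := by
      rw [Fin.val_ofNat, Nat.mod_eq_of_lt (by omega)]
    simp only [hv, hmono d hd]
    rw [show n - d 0 = d 1 by omega, mul_assoc]

lemma evalForm_compForm {n : ℕ} (a : Coeffs n) (g : Matrix (Fin 2) (Fin 2) ℂ) (x : Fin 2 → ℂ) :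
    evalForm (compForm a g) x = evalForm a (Matrix.vecMul x g) := by
  rw [compForm, evalForm_ofPoly, ← eval_toPoly, MvPolynomial.eval, MvPolynomial.eval₂Hom_bind₁]
  · congr 2
    funext j
    simp [Matrix.vecMul, dotProduct, mul_comm]
  · have h := (toPoly_isHomogeneous a).aeval (n := 1)
      (fun j => ∑ i : Fin 2, MvPolynomial.C (g i j) * MvPolynomial.X i)
      fun j => MvPolynomial.IsHomogeneous.sum _ _ _ fun i _ =>
        MvPolynomial.isHomogeneous_C_mul_X _ _
    rwa [one_mul] at h

lemma continuous_compForm {n : ℕ} (g : Matrix (Fin 2) (Fin 2) ℂ) :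
    Continuous fun a : Coeffs n => compForm a g := by
  refine continuous_pi fun j => ?_
  simp only [compForm, ofPoly, toPoly, map_sum, map_mul, MvPolynomial.bind₁_C_right,
    MvPolynomial.coeff_sum, mul_assoc, MvPolynomial.coeff_C_mul]
  fun_prop

lemma evalForm_injective {n : ℕ} {a b : Coeffs n} (h : ∀ x, evalForm a x = evalForm b x) :
    a = b := by
  have key : ∑ i : Fin (n + 1), Polynomial.C (a i) * Polynomial.X ^ (i : ℕ) =
      ∑ i : Fin (n + 1), Polynomial.C (b i) * Polynomial.X ^ (i : ℕ) :=
    Polynomial.funext fun t => by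
      simpa [evalForm, Polynomial.eval_finsetSum] using h ![t, 1]
  funext j
  simpa [Polynomial.finsetSum_coeff, Polynomial.coeff_X_pow, Fin.val_inj] using
    congrArg (fun p => Polynomial.coeff p (j : ℕ)) key

/-- The values at `x` of a pair of binary forms. -/
def evalPair {n : ℕ} (v : Coeffs n × Coeffs n) (x : Fin 2 → ℂ) : ℂ × ℂ :=
  (evalForm v.1 x, evalForm v.2 x)

lemma continuous_evalPair {n : ℕ} :
    Continuous fun p : (Coeffs n × Coeffs n) × (Fin 2 → ℂ) => evalPair p.1 p.2 := by
  unfold evalPair evalForm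
  fun_prop

lemma evalPair_ne_zero {n : ℕ} (v : RatRep n) {x : Fin 2 → ℂ} (hx : x ≠ 0) :
    evalPair v.val x ≠ 0 := by
  intro h
  rcases v.property x hx with h' | h'
  · exact h' (congrArg Prod.fst h)
  · exact h' (congrArg Prod.snd h)

lemma evalPair_smul {n : ℕ} (v : Coeffs n × Coeffs n) (t : ℂ) (x : Fin 2 → ℂ) :
    evalPair v (t • x) = t ^ n • evalPair v x := by
  have h : ∀ a : Coeffs n, evalForm a (t • x) = t ^ n * evalForm a x := fun a => by
    rw [evalForm, evalForm, Finset.mul_sum]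
    refine Finset.sum_congr rfl fun i _ => ?_
    have hi : t ^ n = t ^ (i : ℕ) * t ^ (n - (i : ℕ)) := by
      rw [← pow_add, Nat.add_sub_cancel' (Nat.lt_succ_iff.mp i.isLt)]
    rw [hi]
    simp only [Pi.smul_apply, smul_eq_mul, mul_pow]
    ring
  ext <;> simp [evalPair, h]

lemma evalPair_zero_right {n : ℕ} (hn : 1 ≤ n) (v : Coeffs n × Coeffs n) :
    evalPair v 0 = 0 := by
  have h := evalPair_smul v 0 0
  rwa [zero_smul, zero_pow (by omega), zero_smul] at h

lemma norm_evalPair_le {n : ℕ} (v : Coeffs n × Coeffs n) (x : Fin 2 → ℂ) :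
    ‖evalPair v x‖ ≤ (n + 1) * ‖v‖ * ‖x‖ ^ n := by
  have h : ∀ a : Coeffs n, ‖a‖ ≤ ‖v‖ → ‖evalForm a x‖ ≤ (n + 1) * ‖v‖ * ‖x‖ ^ n := fun a ha => by
    calc ‖evalForm a x‖ ≤ ∑ _i : Fin (n + 1), ‖v‖ * ‖x‖ ^ n := by
          refine norm_sum_le_of_le _ fun i _ => ?_
          have hi : ‖x‖ ^ n = ‖x‖ ^ (i : ℕ) * ‖x‖ ^ (n - (i : ℕ)) := by
            rw [← pow_add, Nat.add_sub_cancel' (Nat.lt_succ_iff.mp i.isLt)]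
          rw [norm_mul, norm_mul, norm_pow, norm_pow, hi, ← mul_assoc]
          gcongr
          · exact (norm_le_pi_norm a i).trans ha
          · exact norm_le_pi_norm x 0
          · exact norm_le_pi_norm x 1
      _ = (n + 1) * ‖v‖ * ‖x‖ ^ n := by simp; ring
  exact max_le (h _ (norm_fst_le v)) (h _ (norm_snd_le v))

lemma evalPair_sub {n : ℕ} (u v : Coeffs n × Coeffs n) (x : Fin 2 → ℂ) :
    evalPair (u - v) x = evalPair u x - evalPair v x := by
  ext <;> simp [evalPair, evalForm, sub_mul, Finset.sum_sub_distrib]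

/-- A uniform lower bound for coprime pairs near a given one. -/
lemma exists_eventually_le_norm_evalPair {n : ℕ} (u : RatRep n) :
    ∃ c > 0, ∀ᶠ w in 𝓝 u.val, ∀ x, c * ‖x‖ ^ n ≤ ‖evalPair w x‖ := by
  have hcont : Continuous fun x => ‖evalPair u.val x‖ :=
    (continuous_evalPair.comp (Continuous.prodMk_right u.val)).norm
  obtain ⟨x₀, hx₀, hmin⟩ := (isCompact_sphere (0 : Fin 2 → ℂ) 1).exists_isMinOn
    (NormedSpace.sphere_nonempty.mpr zero_le_one) hcont.continuousOn
  have hx₀' : x₀ ≠ 0 := by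
    rintro rfl
    simp at hx₀
  set m := ‖evalPair u.val x₀‖ with hm
  have hmpos : 0 < m := norm_pos_iff.mpr (evalPair_ne_zero u hx₀')
  have hlow : ∀ x, m * ‖x‖ ^ n ≤ ‖evalPair u.val x‖ := fun x => by
    rcases eq_or_ne x 0 with rfl | hx
    · rcases Nat.eq_zero_or_pos n with rfl | hn
      · have h := evalPair_smul u.val 0 x₀
        rw [zero_smul, pow_zero, one_smul] at h
        rw [h, pow_zero, mul_one]
      · simp [zero_pow hn.ne']
    · have hxn : ‖x‖ ≠ 0 := norm_ne_zero_iff.mpr hx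
      have hs : ((‖x‖ : ℂ)⁻¹ • x) ∈ Metric.sphere (0 : Fin 2 → ℂ) 1 := by
        simp [norm_smul, hxn]
      have hle : m ≤ ‖evalPair u.val ((‖x‖ : ℂ)⁻¹ • x)‖ := hmin hs
      rw [evalPair_smul, norm_smul, norm_pow, norm_inv, Complex.norm_real, norm_norm, inv_pow,
        inv_mul_eq_div] at hle
      exact (le_div_iff₀ (by positivity)).mp hle
  refine ⟨m / 2, half_pos hmpos, ?_⟩
  have hr : 0 < m / (2 * (n + 1)) := by positivity
  filter_upwards [Metric.ball_mem_nhds u.val hr] with w hw x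
  rw [Metric.mem_ball, dist_comm, dist_eq_norm, lt_div_iff₀ (by positivity)] at hw
  have h1 := norm_evalPair_le (u.val - w) x
  rw [evalPair_sub] at h1
  have h2 : (n + 1) * ‖u.val - w‖ * ‖x‖ ^ n ≤ m / 2 * ‖x‖ ^ n := by
    gcongr
    linarith
  have h3 := norm_sub_norm_le (evalPair u.val x) (evalPair w x)
  have h4 := hlow x
  linarith

/-- Two coprime pairs are equivalent if they differ by a linear change of variables. -/
def substRel (n : ℕ) (u v : RatRep n) : Prop :=
  ∃ g : GL (Fin 2) ℂ, ∀ x, evalPair v.val x = evalPair u.val (Matrix.vecMul x g.val)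

lemma substRel_equivalence (n : ℕ) : Equivalence (substRel n) where
  refl u := ⟨1, fun x => by simp⟩
  symm := by
    rintro u v ⟨g, hg⟩
    refine ⟨g⁻¹, fun x => ?_⟩
    rw [hg, Matrix.vecMul_vecMul, ← Units.val_mul, inv_mul_cancel, Units.val_one, Matrix.vecMul_one]
  trans := by
    rintro u v w ⟨g, hg⟩ ⟨k, hk⟩
    refine ⟨k * g, fun x => ?_⟩
    rw [hk, hg, Matrix.vecMul_vecMul, Units.val_mul]

lemma substRel_of_scaleRel {n : ℕ} (hn : 1 ≤ n) {u v : RatRep n} (h : scaleRel n u v) :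
    substRel n u v := by
  obtain ⟨c, hc⟩ := h
  obtain ⟨t, ht⟩ := IsAlgClosed.exists_pow_nat_eq (c : ℂ) (Nat.lt_of_lt_of_le one_pos hn)
  have ht0 : t ≠ 0 := by
    rintro rfl
    rw [zero_pow (by omega)] at ht
    exact c.ne_zero ht.symm
  refine ⟨Matrix.GeneralLinearGroup.mkOfDetNeZero (Matrix.diagonal fun _ => t) ?_, fun x => ?_⟩
  · simp [ht0]
  · have hx : Matrix.vecMul x (Matrix.diagonal fun _ => t) = t • x := by
      ext j
      simp [Matrix.vecMul_diagonal, mul_comm]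
    change _ = evalPair u.val (Matrix.vecMul x (Matrix.diagonal fun _ => t))
    rw [hx, evalPair_smul, ht, hc]
    ext <;> simp [evalPair, evalForm, Finset.mul_sum, mul_assoc, Units.smul_def]

lemma vecMul_ne_zero {x : Fin 2 → ℂ} (hx : x ≠ 0) (g : GL (Fin 2) ℂ) :
    Matrix.vecMul x g.val ≠ 0 := fun h => hx <| by
  rw [← Matrix.vecMul_one x, ← Units.val_one, ← mul_inv_cancel g, Units.val_mul,
    ← Matrix.vecMul_vecMul, h, Matrix.zero_vecMul]

/-- Linear change of variables on coprime pairs. -/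
def substPair {n : ℕ} (g : GL (Fin 2) ℂ) (u : RatRep n) : RatRep n :=
  ⟨(compForm u.val.1 g.val, compForm u.val.2 g.val), fun x hx => by
    rw [evalForm_compForm, evalForm_compForm]
    exact u.property _ (vecMul_ne_zero hx g)⟩

lemma continuous_substPair {n : ℕ} (g : GL (Fin 2) ℂ) :
    Continuous (substPair g : RatRep n → RatRep n) :=
  (((continuous_compForm g.val).comp (continuous_fst.comp continuous_subtype_val)).prodMk
    ((continuous_compForm g.val).comp (continuous_snd.comp continuous_subtype_val))).subtype_mk _

lemma substRel_iff_exists_substPair {n : ℕ} {u v : RatRep n} :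
    substRel n u v ↔ ∃ g : GL (Fin 2) ℂ, substPair g u = v := by
  refine exists_congr fun g => ⟨fun h => Subtype.ext (Prod.ext ?_ ?_), ?_⟩
  · exact evalForm_injective fun x =>
      (evalForm_compForm _ _ _).trans (congrArg Prod.fst (h x)).symm
  · exact evalForm_injective fun x =>
      (evalForm_compForm _ _ _).trans (congrArg Prod.snd (h x)).symm
  · rintro rfl x
    exact Prod.ext (evalForm_compForm _ _ _) (evalForm_compForm _ _ _)

/-- The projection from coprime pairs to the moduli space. -/
def toModuli (n : ℕ) (u : RatRep n) : Xn n := pr n (Quot.mk _ u)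

lemma toModuli_eq_iff {n : ℕ} (hn : 1 ≤ n) {u v : RatRep n} :
    toModuli n u = toModuli n v ↔ substRel n u v := by
  constructor
  · let s : Setoid (RatRep n) := ⟨substRel n, substRel_equivalence n⟩
    let f : Fn n → Quotient s :=
      Quot.lift (Quotient.mk s) fun a b hab => Quotient.sound (substRel_of_scaleRel hn hab)
    let F : Xn n → Quotient s := Quot.lift f (by
      rintro _ _ ⟨a, b, g, rfl, rfl, hg⟩
      exact Quotient.sound (substRel_iff_exists_substPair.mpr ⟨g, Subtype.ext hg.symm⟩))
    exact fun h => Quotient.exact (s := s) (congrArg F h)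
  · intro h
    obtain ⟨g, rfl⟩ := substRel_iff_exists_substPair.mp h
    exact Quot.sound ⟨u, substPair g u, g, rfl, rfl, rfl⟩

lemma isOpenQuotientMap_toModuli {n : ℕ} (hn : 1 ≤ n) : IsOpenQuotientMap (toModuli n) := by
  have hq : IsQuotientMap (toModuli n) := isQuotientMap_quot_mk.comp isQuotientMap_quot_mk
  refine ⟨hq.surjective, hq.continuous, fun U hU => hq.isOpen_preimage.mp ?_⟩
  have h : toModuli n ⁻¹' (toModuli n '' U) = ⋃ g : GL (Fin 2) ℂ, substPair g ⁻¹' U := by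
    ext v
    simp only [Set.mem_preimage, Set.mem_image, Set.mem_iUnion]
    constructor
    · rintro ⟨u, hu, huv⟩
      obtain ⟨g, hg⟩ := substRel_iff_exists_substPair.mp ((toModuli_eq_iff hn).mp huv.symm)
      exact ⟨g, hg ▸ hu⟩
    · rintro ⟨g, hg⟩
      exact ⟨_, hg, ((toModuli_eq_iff hn).mpr
        (substRel_iff_exists_substPair.mpr ⟨g, rfl⟩)).symm⟩
  rw [h]
  exact isOpen_iUnion fun g => hU.preimage (continuous_substPair g)

lemma isClosed_substRel {n : ℕ} (hn : 1 ≤ n) :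
    IsClosed {p : RatRep n × RatRep n | substRel n p.1 p.2} := by
  refine IsSeqClosed.isClosed ?_
  rintro p ⟨u, v⟩ hp hlim
  choose g hg using hp
  change Tendsto p atTop (𝓝 (u, v)) at hlim
  have hu : Tendsto (fun k => (p k).1.val) atTop (𝓝 u.val) :=
    (continuous_subtype_val.comp continuous_fst).continuousAt.tendsto.comp hlim
  have hv : Tendsto (fun k => (p k).2.val) atTop (𝓝 v.val) :=
    (continuous_subtype_val.comp continuous_snd).continuousAt.tendsto.comp hlim
  obtain ⟨c, hc, hlow⟩ := exists_eventually_le_norm_evalPair u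
  have hC : ∀ᶠ k in atTop, ‖(p k).2.val‖ < ‖v.val‖ + 1 :=
    hv.norm.eventually (gt_mem_nhds (lt_add_one _))
  set K : ℝ := max 1 ((n + 1) * (‖v.val‖ + 1) / c) with hK
  let G : ℕ → Fin 2 → Fin 2 → ℂ := fun k => (g k).val
  have hrow : ∀ᶠ k in atTop, ‖G k‖ ≤ K := by
    filter_upwards [hu.eventually hlow, hC] with k hk hCk
    refine (pi_norm_le_iff_of_nonneg (by positivity)).mpr fun i => ?_
    have h1 := hk (Matrix.vecMul (Pi.single i 1) (g k).val)
    rw [← hg k, Matrix.single_one_vecMul] at h1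
    have h2 := norm_evalPair_le (p k).2.val (Pi.single i 1)
    have he : ‖(Pi.single i 1 : Fin 2 → ℂ)‖ = 1 := by rw [Pi.norm_single, norm_one]
    rw [he, one_pow, mul_one] at h2
    have h3 : ‖G k i‖ ^ n ≤ (n + 1) * (‖v.val‖ + 1) / c := by
      rw [le_div_iff₀ hc, mul_comm]
      refine h1.trans (h2.trans ?_)
      gcongr
    by_contra! hlt
    have h4 : 1 ≤ ‖G k i‖ := (le_max_left _ _).trans hlt.le
    have h5 : ‖G k i‖ ≤ ‖G k i‖ ^ n := le_self_pow₀ h4 (by omega)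
    exact absurd ((h5.trans h3).trans (le_max_right _ _)) (not_le.mpr hlt)
  obtain ⟨A, -, φ, hφ, hA⟩ := tendsto_subseq_of_frequently_bounded
    (Metric.isBounded_closedBall (x := (0 : Fin 2 → Fin 2 → ℂ)) (r := K))
    (x := G)
    (hrow.mono fun k hk => mem_closedBall_zero_iff.mpr hk).frequently
  have hvec : ∀ x : Fin 2 → ℂ, Continuous fun M : Fin 2 → Fin 2 → ℂ =>
      Matrix.vecMul x (Matrix.of M) := fun x => by
    refine continuous_pi fun j => ?_
    change Continuous fun M : Fin 2 → Fin 2 → ℂ => ∑ i, x i * M i j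
    fun_prop
  have hlimit : ∀ x, evalPair v.val x = evalPair u.val (Matrix.vecMul x (Matrix.of A)) := by
    intro x
    have hvk : Tendsto (fun k => ((p (φ k)).2.val, x)) atTop (𝓝 (v.val, x)) :=
      Tendsto.prodMk_nhds (hv.comp hφ.tendsto_atTop) tendsto_const_nhds
    have huk : Tendsto (fun k => ((p (φ k)).1.val, Matrix.vecMul x (Matrix.of (G (φ k))))) atTop
        (𝓝 (u.val, Matrix.vecMul x (Matrix.of A))) :=
      Tendsto.prodMk_nhds (hu.comp hφ.tendsto_atTop) (((hvec x).tendsto A).comp hA)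
    have hl := (continuous_evalPair.tendsto (v.val, x)).comp hvk
    have hr := (continuous_evalPair.tendsto (u.val, Matrix.vecMul x (Matrix.of A))).comp huk
    exact tendsto_nhds_unique hl (hr.congr fun k => (hg (φ k) x).symm)
  have hdet : (Matrix.of A).det ≠ 0 := fun h => by
    obtain ⟨x, hx, hx0⟩ := Matrix.exists_vecMul_eq_zero_iff.mpr h
    exact evalPair_ne_zero v hx (by rw [hlimit, hx0, evalPair_zero_right hn])
  exact ⟨Matrix.GeneralLinearGroup.mkOfDetNeZero (Matrix.of A) hdet, hlimit⟩

/-- For every integer `n ≥ 1`, the moduli space `𝒳_n = F_n / PGL(2,ℂ)` of complex rational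
functions of degree `n`, with the quotient topology, is Hausdorff. -/
theorem moduli_space_t2 (n : ℕ) (hn : 1 ≤ n) : T2Space (Xn n) := by
  rw [t2Space_iff_of_isOpenQuotientMap (isOpenQuotientMap_toModuli hn)]
  simpa only [toModuli_eq_iff hn] using isClosed_substRel hn
end
end

section
/- Let n ≥ 1 and let P, Q be coprime homogeneous polynomials of degree n in x₀, x₁ over ℂ. Then the defect function c ↦ defect(c) is nonzero for only finitely many points c ∈ ℙ¹(ℂ), and the sum of defect(c) over all c ∈ ℙ¹(ℂ) equals 2n − 2. (This is the Riemann–Hurwitz count for the degree-n branched covering ℙ¹(ℂ) → ℙ¹(ℂ) given by [x₀:x₁] ↦ [P(x₀,x₁):Q(x₀,x₁)]: the sum of the multiplicities of its critical values is 2n − χ(S²) = 2n − 2.) -/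
/-!
Setup: a binary form of degree `n` in `x₀, x₁` over `ℂ` is encoded by its coefficient
vector `Fin (n+1) → ℂ`, the form being `∑ i, a i * x₀ ^ i * x₁ ^ (n - i)`.  The projective
line `ℙ¹(ℂ)` is the projectivization of `ℂ² = Fin 2 → ℂ`.  For coprime forms `P, Q` of
degree `n` and a point `c = [c₀ : c₁] ∈ ℙ¹(ℂ)`, the fiber of the branched covering
`[P : Q] : ℙ¹(ℂ) → ℙ¹(ℂ)` over `c` is `{ [x₀ : x₁] | c₁ P(x₀,x₁) - c₀ Q(x₀,x₁) = 0 }`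
(a condition invariant under rescaling of both `c` and `x`, so it may be tested on the
chosen representatives `rep`), and the defect (multiplicity) of `c` is
`n - #fiber(c)`.
-/

open Filter Topology

noncomputable section

/-- The fiber of the rational map `[P : Q] : ℙ¹(ℂ) → ℙ¹(ℂ)` over the point
`c = [c₀ : c₁]`: the set of `[x₀ : x₁]` with `c₁ · P(x₀,x₁) - c₀ · Q(x₀,x₁) = 0`. -/
def fiberSet {n : ℕ} (P Q : Coeffs n) (c : Projectivization ℂ (Fin 2 → ℂ)) :
    Set (Projectivization ℂ (Fin 2 → ℂ)) :=
  { x | c.rep 1 * evalForm P x.rep - c.rep 0 * evalForm Q x.rep = 0 }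

/-- The defect (= multiplicity as a critical value) of `c ∈ ℙ¹(ℂ)` for the degree-`n`
branched covering `[P : Q]`: `n` minus the number of points of the fiber over `c`. -/
def defect {n : ℕ} (P Q : Coeffs n) (c : Projectivization ℂ (Fin 2 → ℂ)) : ℕ :=
  n - (fiberSet P Q c).ncard

open Polynomial

/-- The dehomogenization `∑ i, a i * X ^ i` of a binary form at `x₁ = 1`. -/
def dehom {n : ℕ} (a : Coeffs n) : ℂ[X] :=
  ∑ i : Fin (n + 1), C (a i) * X ^ (i : ℕ)

section Forms

variable {n : ℕ}

lemma eval_dehom (a : Coeffs n) (t : ℂ) : (dehom a).eval t = evalForm a ![t, 1] := by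
  simp [dehom, evalForm, eval_finsetSum]

lemma coeff_dehom (a : Coeffs n) : (dehom a).coeff n = evalForm a ![1, 0] := by
  have h : ∀ i : Fin (n + 1), (n = (i : ℕ)) ↔ n - (i : ℕ) = 0 := fun i => by omega
  simp [dehom, evalForm, coeff_C_mul, coeff_X_pow, zero_pow_eq, h]

lemma natDegree_dehom_le (a : Coeffs n) : (dehom a).natDegree ≤ n := by
  refine natDegree_sum_le_of_forall_le _ _ fun i _ => ?_
  exact (natDegree_C_mul_X_pow_le _ _).trans (by omega)

lemma natDegree_dehom_of_coeff_ne_zero {a : Coeffs n} (h : (dehom a).coeff n ≠ 0) :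
    (dehom a).natDegree = n :=
  natDegree_eq_of_le_of_coeff_ne_zero (natDegree_dehom_le a) h

lemma natDegree_dehom_lt {a : Coeffs n} (ha : dehom a ≠ 0) (h : (dehom a).coeff n = 0) :
    (dehom a).natDegree < n := by
  refine lt_of_le_of_ne (natDegree_dehom_le a) fun he => ha ?_
  rwa [← leadingCoeff_eq_zero, leadingCoeff, he]

lemma evalForm_smul_vec (a : Coeffs n) (k : ℂ) (x : Fin 2 → ℂ) :
    evalForm a (k • x) = k ^ n * evalForm a x := by
  simp only [evalForm, Finset.mul_sum, Pi.smul_apply, smul_eq_mul]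
  refine Finset.sum_congr rfl fun i _ => ?_
  obtain ⟨j, hj⟩ : ∃ j, n = i + j := ⟨n - i, by omega⟩
  have : n - (i : ℕ) = j := by omega
  rw [this, mul_pow, mul_pow, show k ^ n = k ^ (i : ℕ) * k ^ j by rw [← pow_add, ← hj]]
  ring

lemma evalForm_comb (a b : Coeffs n) (r s : ℂ) (x : Fin 2 → ℂ) :
    evalForm (r • a - s • b) x = r * evalForm a x - s * evalForm b x := by
  simp only [evalForm, Finset.mul_sum, ← Finset.sum_sub_distrib, Pi.sub_apply, Pi.smul_apply,
    smul_eq_mul]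
  exact Finset.sum_congr rfl fun i _ => by ring

lemma dehom_comb (a b : Coeffs n) (r s : ℂ) :
    dehom (r • a - s • b) = C r * dehom a - C s * dehom b := by
  simp only [dehom, Finset.mul_sum, ← Finset.sum_sub_distrib, Pi.sub_apply, Pi.smul_apply,
    smul_eq_mul, C_sub, C_mul]
  exact Finset.sum_congr rfl fun i _ => by ring

lemma exists_evalForm_eq_zero (hn : 1 ≤ n) (a : Coeffs n) :
    ∃ x : Fin 2 → ℂ, x ≠ 0 ∧ evalForm a x = 0 := by
  by_cases h : (dehom a).coeff n = 0
  · exact ⟨![1, 0], by simp, by rw [← coeff_dehom, h]⟩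
  · have hd := natDegree_dehom_of_coeff_ne_zero h
    obtain ⟨t, ht⟩ := IsAlgClosed.exists_root (dehom a)
      fun h0 => by rw [natDegree_eq_of_degree_eq_some (n := 0) h0] at hd; omega
    exact ⟨![t, 1], by simp, by rw [← eval_dehom]; exact ht⟩

lemma IsCoprimePair.dehom_ne_zero {a b : Coeffs n} (hn : 1 ≤ n) (h : IsCoprimePair a b) :
    dehom a ≠ 0 := by
  intro ha
  have ha0 : a = 0 := by
    funext i
    have := congrArg (fun p => p.coeff i) ha
    simpa [dehom, finsetSum_coeff, coeff_C_mul, coeff_X_pow, Fin.val_inj] using this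
  obtain ⟨x, hx, hb⟩ := exists_evalForm_eq_zero hn b
  rcases h x hx with h | h
  · exact h (by simp [ha0, evalForm])
  · exact h hb

/-- A nontrivial member of the pencil spanned by a coprime pair extends to a coprime pair with
the same Wronskian. -/
lemma IsCoprimePair.exists_complement {P Q : Coeffs n} (h : IsCoprimePair P Q) {c : Fin 2 → ℂ}
    (hc : c ≠ 0) :
    ∃ b : Coeffs n, IsCoprimePair (c 1 • P - c 0 • Q) b ∧
      wronskian (dehom (c 1 • P - c 0 • Q)) (dehom b) = wronskian (dehom P) (dehom Q) := by
  obtain ⟨r, s, hrs⟩ : ∃ r s : ℂ, c 0 * s - c 1 * r = 1 := by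
    by_cases h0 : c 0 = 0
    · have h1 : c 1 ≠ 0 := fun h1 => hc (by funext i; fin_cases i <;> simp [h0, h1])
      exact ⟨-(c 1)⁻¹, 0, by simp [h1]⟩
    · exact ⟨0, (c 0)⁻¹, by simp [h0]⟩
  refine ⟨s • P - r • Q, fun x hx => ?_, ?_⟩
  · by_contra! hz
    rw [evalForm_comb, evalForm_comb] at hz
    obtain ⟨h1, h2⟩ := hz
    rcases h x hx with hp | hq
    · exact hp (by linear_combination c 0 * h2 - r * h1 - evalForm P x * hrs)
    · exact hq (by linear_combination c 1 * h2 - s * h1 - evalForm Q x * hrs)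
  · have hC : C (c 0) * C s - C (c 1) * C r = (1 : ℂ[X]) := by
      rw [← C_mul, ← C_mul, ← C_sub, hrs, C_1]
    simp only [dehom_comb, wronskian, derivative_sub, derivative_C_mul]
    linear_combination
      (dehom P * derivative (dehom Q) - derivative (dehom P) * dehom Q) * hC

end Forms

lemma rootMultiplicity_wronskian {g h : ℂ[X]} {t : ℂ} (hg : g ≠ 0) (hgt : g.IsRoot t)
    (hht : h.eval t ≠ 0) :
    rootMultiplicity t (wronskian g h) + 1 = rootMultiplicity t g := by
  obtain ⟨u, hu, hdvd⟩ := exists_eq_pow_rootMultiplicity_mul_and_not_dvd g hg t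
  obtain ⟨m, hm⟩ := Nat.exists_eq_succ_of_ne_zero ((rootMultiplicity_pos hg).2 hgt).ne'
  rw [hm] at hu ⊢
  rw [dvd_iff_isRoot, IsRoot.def] at hdvd
  set v := (X - C t) * u * derivative h - (C ((m : ℂ) + 1) * u + (X - C t) * derivative u) * h
  have hw : wronskian g h = (X - C t) ^ m * v := by
    simp only [wronskian, hu, v, derivative_mul, derivative_X_sub_C_pow, Nat.succ_eq_add_one,
      Nat.add_sub_cancel, Nat.cast_add, Nat.cast_one, C_add, C_1, map_natCast]
    ring
  have hv : v.eval t ≠ 0 := by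
    have : (m : ℂ) + 1 ≠ 0 := Nat.cast_add_one_ne_zero m
    simp [v, this, hdvd, hht]
  have hv0 : v ≠ 0 := by rintro h; simp [h] at hv
  rw [hw, rootMultiplicity_mul (mul_ne_zero (pow_ne_zero _ (X_sub_C_ne_zero t)) hv0),
    rootMultiplicity_X_sub_C_pow, rootMultiplicity_eq_zero hv]

lemma natDegree_wronskian {g h : ℂ[X]} (hg : g ≠ 0) (hlt : g.natDegree < h.natDegree) :
    wronskian g h ≠ 0 ∧ (wronskian g h).natDegree + 1 = g.natDegree + h.natDegree := by
  obtain ⟨e, he⟩ := Nat.exists_eq_succ_of_ne_zero (by omega : h.natDegree ≠ 0)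
  have hh : h ≠ 0 := by rintro rfl; simp at he
  have h1 : (g * derivative h).coeff (g.natDegree + e) =
      g.leadingCoeff * (h.leadingCoeff * (e + 1)) := by
    rw [coeff_mul_add_eq_of_natDegree_le le_rfl (by have := natDegree_derivative_le h; omega),
      coeff_derivative, leadingCoeff, leadingCoeff, he]
  have h2 : (derivative g * h).coeff (g.natDegree + e) =
      g.leadingCoeff * g.natDegree * h.leadingCoeff := by
    rcases Nat.eq_zero_or_eq_succ_pred g.natDegree with h0 | h0
    · have hg' : derivative g = 0 := derivative_of_natDegree_zero h0
      simp [hg', h0]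
    · set d := g.natDegree.pred
      rw [show g.natDegree + e = d + (e + 1) by omega,
        coeff_mul_add_eq_of_natDegree_le (by have := natDegree_derivative_le g; omega) (by omega),
        coeff_derivative, leadingCoeff, leadingCoeff, he, h0]
      push_cast; ring
  have hc : (wronskian g h).coeff (g.natDegree + e) ≠ 0 := by
    have : g.leadingCoeff * (h.leadingCoeff * (e + 1)) -
        g.leadingCoeff * g.natDegree * h.leadingCoeff =
        g.leadingCoeff * h.leadingCoeff * (((e + 1 : ℕ) : ℂ) - (g.natDegree : ℂ)) := by
      push_cast; ring
    rw [wronskian, coeff_sub, h1, h2, this]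
    refine mul_ne_zero (by simp [hg, hh]) (sub_ne_zero.2 fun h => ?_)
    have := Nat.cast_injective h
    omega
  have hw : wronskian g h ≠ 0 := by rintro h; simp [h] at hc
  have := le_natDegree_of_ne_zero hc
  have := natDegree_wronskian_lt_add hw
  exact ⟨hw, by omega⟩

lemma natDegree_eq_sum_rootMultiplicity (p : ℂ[X]) :
    p.natDegree = ∑ t ∈ p.roots.toFinset, rootMultiplicity t p := by
  rw [← IsAlgClosed.card_roots_eq_natDegree, ← Multiset.toFinset_sum_count_eq]
  simp

/-- The affine point `[t : 1]`. -/
def affinePoint (t : ℂ) : Projectivization ℂ (Fin 2 → ℂ) :=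
  Projectivization.mk ℂ ![t, 1] (by simp)

/-- The point at infinity `[1 : 0]`. -/
def inftyPoint : Projectivization ℂ (Fin 2 → ℂ) :=
  Projectivization.mk ℂ ![1, 0] (by simp)

lemma mk_eq_iff_rep (v : Fin 2 → ℂ) (hv : v ≠ 0) (c : Projectivization ℂ (Fin 2 → ℂ)) :
    Projectivization.mk ℂ v hv = c ↔ c.rep 1 * v 0 - c.rep 0 * v 1 = 0 := by
  conv_lhs => rw [← c.mk_rep]
  rw [Projectivization.mk_eq_mk_iff']
  constructor
  · rintro ⟨a, rfl⟩
    simp only [Pi.smul_apply, smul_eq_mul]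
    ring
  · intro h
    by_cases h0 : c.rep 0 = 0
    · have h1 : c.rep 1 ≠ 0 := fun h1 => c.rep_nonzero (by funext i; fin_cases i <;> simp [h0, h1])
      refine ⟨v 1 / c.rep 1, ?_⟩
      have : v 0 = 0 := by simpa [h0, h1] using h
      funext i; fin_cases i <;> simp [h0, h1, this]
    · refine ⟨v 0 / c.rep 0, ?_⟩
      funext i; fin_cases i
      · simp [h0]
      · simp only [Pi.smul_apply, smul_eq_mul]
        field_simp
        simp only [Fin.mk_one]
        linear_combination h

lemma mk_eq_mk_iff_cross (v w : Fin 2 → ℂ) (hv : v ≠ 0) (hw : w ≠ 0) :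
    Projectivization.mk ℂ v hv = Projectivization.mk ℂ w hw ↔ w 1 * v 0 - w 0 * v 1 = 0 := by
  obtain ⟨a, ha⟩ := Projectivization.exists_smul_eq_mk_rep ℂ w hw
  rw [mk_eq_iff_rep, ← ha]
  simp only [Units.smul_def, Pi.smul_apply, smul_eq_mul]
  rw [show (a : ℂ) * w 1 * v 0 - a * w 0 * v 1 = a * (w 1 * v 0 - w 0 * v 1) by ring]
  simp

lemma affinePoint_injective : Function.Injective affinePoint := fun s t h => by
  rw [affinePoint, affinePoint, mk_eq_mk_iff_cross] at h
  simpa [sub_eq_zero] using h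

lemma affinePoint_ne_inftyPoint (t : ℂ) : affinePoint t ≠ inftyPoint := by
  rw [affinePoint, inftyPoint, Ne, mk_eq_mk_iff_cross]
  simp

lemma eq_affinePoint_or_eq_inftyPoint (x : Projectivization ℂ (Fin 2 → ℂ)) :
    (∃ t, x = affinePoint t) ∨ x = inftyPoint := by
  by_cases h : x.rep 1 = 0
  · right
    rw [eq_comm, inftyPoint, mk_eq_iff_rep]
    simp [h]
  · left
    refine ⟨x.rep 0 / x.rep 1, ?_⟩
    rw [eq_comm, affinePoint, mk_eq_iff_rep]
    simp [mul_div_cancel₀, h]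

section Fibers

variable {n : ℕ}

lemma evalForm_rep_mk_eq_zero_iff (a : Coeffs n) (v : Fin 2 → ℂ) (hv : v ≠ 0) :
    evalForm a (Projectivization.mk ℂ v hv).rep = 0 ↔ evalForm a v = 0 := by
  obtain ⟨k, hk⟩ := Projectivization.exists_smul_eq_mk_rep ℂ v hv
  rw [← hk, Units.smul_def, evalForm_smul_vec]
  simp

lemma ncard_zeros (a : Coeffs n) (ha : dehom a ≠ 0) :
    {x : Projectivization ℂ (Fin 2 → ℂ) | evalForm a x.rep = 0}.ncard =
      (dehom a).roots.toFinset.card + if (dehom a).coeff n = 0 then 1 else 0 := by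
  classical
  have haff : ∀ t, evalForm a (affinePoint t).rep = 0 ↔ t ∈ (dehom a).roots.toFinset :=
    fun t => by
      rw [affinePoint, evalForm_rep_mk_eq_zero_iff, ← eval_dehom]
      simp [ha]
  have hinf : evalForm a inftyPoint.rep = 0 ↔ (dehom a).coeff n = 0 := by
    rw [inftyPoint, evalForm_rep_mk_eq_zero_iff, ← coeff_dehom]
  have hset : {x : Projectivization ℂ (Fin 2 → ℂ) | evalForm a x.rep = 0} =
      (((dehom a).roots.toFinset.image affinePoint ∪
        if (dehom a).coeff n = 0 then {inftyPoint} else ∅ : Finset _) : Set _) := by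
    ext x
    rcases eq_affinePoint_or_eq_inftyPoint x with ⟨t, rfl⟩ | rfl
    · rw [Set.mem_ofPred_eq, haff]
      split_ifs <;> simp [affinePoint_injective.eq_iff, affinePoint_ne_inftyPoint]
    · rw [Set.mem_ofPred_eq, hinf]
      split_ifs with h <;> simp [h, affinePoint_ne_inftyPoint]
  rw [hset, Set.ncard_coe_finset, Finset.card_union_of_disjoint,
    Finset.card_image_of_injective _ affinePoint_injective]
  · split_ifs <;> rfl
  · split_ifs <;> simp [affinePoint_ne_inftyPoint]

lemma IsCoprimePair.natDegree_wronskian_dehom {a b : Coeffs n} (hn : 1 ≤ n)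
    (h : IsCoprimePair a b) (ha : (dehom a).coeff n = 0) :
    wronskian (dehom a) (dehom b) ≠ 0 ∧
      (wronskian (dehom a) (dehom b)).natDegree + 1 = (dehom a).natDegree + n := by
  have hb : (dehom b).coeff n ≠ 0 := by
    rw [coeff_dehom] at *
    exact (h ![1, 0] (by simp)).resolve_left (not_not.2 ha)
  have ha0 := h.dehom_ne_zero hn
  have := natDegree_wronskian ha0 (h := dehom b)
    (by rw [natDegree_dehom_of_coeff_ne_zero hb]; exact natDegree_dehom_lt ha0 ha)
  rwa [natDegree_dehom_of_coeff_ne_zero hb] at this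

lemma IsCoprimePair.sub_ncard_zeros {a b : Coeffs n} (hn : 1 ≤ n) (h : IsCoprimePair a b) :
    n - {x : Projectivization ℂ (Fin 2 → ℂ) | evalForm a x.rep = 0}.ncard =
      (∑ t ∈ (dehom a).roots.toFinset, rootMultiplicity t (wronskian (dehom a) (dehom b))) +
      if (dehom a).coeff n = 0 then 2 * n - 2 - (wronskian (dehom a) (dehom b)).natDegree
      else 0 := by
  have ha := h.dehom_ne_zero hn
  have hsum : (∑ t ∈ (dehom a).roots.toFinset,
      rootMultiplicity t (wronskian (dehom a) (dehom b))) + (dehom a).roots.toFinset.card =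
      (dehom a).natDegree := by
    rw [natDegree_eq_sum_rootMultiplicity, Finset.card_eq_sum_ones, ← Finset.sum_add_distrib]
    refine Finset.sum_congr rfl fun t ht => ?_
    have hr : (dehom a).IsRoot t := by simpa [ha] using ht
    refine rootMultiplicity_wronskian ha hr ?_
    rw [IsRoot.def, eval_dehom] at hr
    rw [eval_dehom]
    exact (h ![t, 1] (by simp)).resolve_left (not_not.2 hr)
  rw [ncard_zeros a ha]
  split_ifs with h0
  · have := (h.natDegree_wronskian_dehom hn h0).2
    have := natDegree_dehom_lt ha h0
    omega
  · have := natDegree_dehom_of_coeff_ne_zero h0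
    omega

lemma IsCoprimePair.evalForm_pair_ne_zero {P Q : Coeffs n} (h : IsCoprimePair P Q)
    {x : Fin 2 → ℂ} (hx : x ≠ 0) : ![evalForm P x, evalForm Q x] ≠ 0 := by
  intro h0
  rcases h x hx with h | h
  · exact h (congrFun h0 0)
  · exact h (congrFun h0 1)

lemma IsCoprimePair.mk_eq_iff {P Q : Coeffs n} (h : IsCoprimePair P Q) {x : Fin 2 → ℂ}
    (hx : x ≠ 0) (c : Projectivization ℂ (Fin 2 → ℂ)) :
    Projectivization.mk ℂ ![evalForm P x, evalForm Q x] (h.evalForm_pair_ne_zero hx) = c ↔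
      evalForm (c.rep 1 • P - c.rep 0 • Q) x = 0 := by
  rw [mk_eq_iff_rep, evalForm_comb]
  simp

end Fibers

/-- Riemann–Hurwitz count for the degree-`n` branched covering `[P : Q] : ℙ¹(ℂ) → ℙ¹(ℂ)`
given by coprime degree-`n` forms `P, Q`: the defect is nonzero for only finitely many
points `c ∈ ℙ¹(ℂ)`, and the sum of all defects (the total multiplicity of the critical
values) equals `2n - 2`. -/
theorem riemann_hurwitz_count (n : ℕ) (hn : 1 ≤ n) (P Q : Coeffs n)
    (hPQ : IsCoprimePair P Q) :
    (Function.support (defect P Q)).Finite ∧ ∑ᶠ c, defect P Q c = 2 * n - 2 := by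
  classical
  set W := wronskian (dehom P) (dehom Q) with hW
  let f : ℂ → Projectivization ℂ (Fin 2 → ℂ) := fun t =>
    Projectivization.mk ℂ ![evalForm P ![t, 1], evalForm Q ![t, 1]]
      (hPQ.evalForm_pair_ne_zero (by simp))
  let z : Projectivization ℂ (Fin 2 → ℂ) :=
    Projectivization.mk ℂ ![evalForm P ![1, 0], evalForm Q ![1, 0]]
      (hPQ.evalForm_pair_ne_zero (by simp))
  have hz : ∀ c, z = c ↔ (dehom (c.rep 1 • P - c.rep 0 • Q)).coeff n = 0 := fun c => by
    rw [coeff_dehom]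
    exact hPQ.mk_eq_iff (by simp) c
  obtain ⟨hW0, hWn⟩ : W ≠ 0 ∧ W.natDegree ≤ 2 * n - 2 := by
    obtain ⟨b, hb, hbW⟩ := hPQ.exists_complement z.rep_nonzero
    obtain ⟨h0, h1⟩ := hb.natDegree_wronskian_dehom hn ((hz z).1 rfl)
    have := natDegree_dehom_lt (hb.dehom_ne_zero hn) ((hz z).1 rfl)
    rw [hbW, ← hW] at h0 h1
    exact ⟨h0, by omega⟩
  have hdef : ∀ c, defect P Q c =
      (∑ t ∈ W.roots.toFinset with f t = c, rootMultiplicity t W) +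
        if z = c then 2 * n - 2 - W.natDegree else 0 := by
    intro c
    obtain ⟨b, hb, hbW⟩ := hPQ.exists_complement c.rep_nonzero
    have hfib : fiberSet P Q c = {x | evalForm (c.rep 1 • P - c.rep 0 • Q) x.rep = 0} := by
      ext x
      simp [fiberSet, evalForm_comb]
    rw [defect, hfib, hb.sub_ncard_zeros hn, hbW]
    simp only [hz]
    congr 1
    symm
    have hmem : ∀ t, t ∈ (dehom (c.rep 1 • P - c.rep 0 • Q)).roots.toFinset ↔ f t = c := by
      intro t
      rw [Multiset.mem_toFinset, mem_roots (hb.dehom_ne_zero hn), IsRoot.def, eval_dehom]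
      exact (hPQ.mk_eq_iff (by simp) c).symm
    refine Finset.sum_subset (fun t ht => (hmem t).2 (Finset.mem_filter.1 ht).2) fun t ht ht' => ?_
    refine rootMultiplicity_eq_zero fun hr => ht' ?_
    simp [hW0, hr.eq_zero, (hmem t).1 ht]
  set S := insert z (W.roots.toFinset.image f) with hS
  have hsupp : Function.support (defect P Q) ⊆ S := by
    intro c hc
    by_contra hcS
    rw [hS, Finset.mem_coe, Finset.mem_insert, Finset.mem_image, not_or] at hcS
    refine hc ?_
    rw [hdef, if_neg (Ne.symm hcS.1), Finset.filter_eq_empty_iff.2 fun t ht h => hcS.2 ⟨t, ht, h⟩,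
      Finset.sum_empty, add_zero]
  refine ⟨S.finite_toSet.subset hsupp, ?_⟩
  rw [finsum_eq_sum_of_support_subset _ hsupp, Finset.sum_congr rfl fun c _ => hdef c,
    Finset.sum_add_distrib, Finset.sum_fiberwise_of_maps_to
      (fun t ht => Finset.mem_insert_of_mem (Finset.mem_image_of_mem f ht)),
    ← natDegree_eq_sum_rootMultiplicity, Finset.sum_ite_eq, if_pos (Finset.mem_insert_self _ _)]
  omega
end
end

section
/- Let n ≥ 1 and let (p_m) be a sequence of complex polynomials in one variable, each of degree exactly n, whose coefficients converge to the coefficients of a polynomial p of degree exactly n. Then for every root α ∈ ℂ of p there exists a sequence (α_m) of complex numbers with p_m(α_m) = 0 for every m and α_m → α. -/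
open Filter Topology Polynomial

/-- A nonconstant polynomial over an algebraically closed normed field has a root `r` whose
distance to `x` is controlled by the value of the polynomial at `x`. -/
theorem Polynomial.exists_isRoot_norm_leadingCoeff_mul_pow_le {K : Type*} [NormedField K]
    [IsAlgClosed K] {f : Polynomial K} (hf : 0 < f.natDegree) (x : K) :
    ∃ r, f.IsRoot r ∧ ‖f.leadingCoeff‖ * ‖x - r‖ ^ f.natDegree ≤ ‖f.eval x‖ := by
  classical
  have hs : f.Splits := IsAlgClosed.splits f
  have hcard : f.roots.card = f.natDegree := splits_iff_card_roots.mp hs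
  have hne : f.roots.toFinset.Nonempty := by
    rw [Multiset.toFinset_nonempty, ← Multiset.card_pos, hcard]
    exact hf
  obtain ⟨r, hr, hmin⟩ := f.roots.toFinset.exists_min_image (fun y => ‖x - y‖) hne
  refine ⟨r, isRoot_of_mem_roots (Multiset.mem_toFinset.mp hr), ?_⟩
  have hprod := Multiset.prod_map_le_prod_map₀ (s := f.roots) (fun _ => ‖x - r‖)
    (fun y => ‖x - y‖) (fun _ _ => norm_nonneg _)
    (fun y hy => hmin y (Multiset.mem_toFinset.mpr hy))
  rw [Multiset.map_const', Multiset.prod_replicate, hcard] at hprod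
  have heval : ‖f.eval x‖ = ‖f.leadingCoeff‖ * (f.roots.map fun y => ‖x - y‖).prod := by
    have hnorm := map_multiset_prod (normHom : K →*₀ ℝ) (f.roots.map fun y => x - y)
    rw [Multiset.map_map] at hnorm
    rw [hs.eval_eq_prod_roots, norm_mul]
    exact congrArg _ hnorm
  rw [heval]
  gcongr

/-- Continuity of roots: if `(pₘ)` is a sequence of complex polynomials, each of degree
exactly `n ≥ 1`, whose coefficients converge to the coefficients of a polynomial `p` of
degree exactly `n`, then for every root `α` of `p` there is a sequence `(αₘ)` with
`pₘ(αₘ) = 0` for every `m` and `αₘ → α`. -/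
theorem exists_roots_tendsto_of_coeff_tendsto
    (n : ℕ) (hn : 1 ≤ n) (p : ℕ → Polynomial ℂ) (q : Polynomial ℂ)
    (hdeg : ∀ m, (p m).degree = (n : ℕ)) (hq : q.degree = (n : ℕ))
    (hconv : ∀ i, Tendsto (fun m => (p m).coeff i) atTop (𝓝 (q.coeff i)))
    (α : ℂ) (hα : q.IsRoot α) :
    ∃ a : ℕ → ℂ, (∀ m, (p m).IsRoot (a m)) ∧ Tendsto a atTop (𝓝 α) := by
  have hnat : ∀ m, (p m).natDegree = n := fun m => natDegree_eq_of_degree_eq_some (hdeg m)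
  have hqnat : q.natDegree = n := natDegree_eq_of_degree_eq_some hq
  choose a ha hle using fun m =>
    (p m).exists_isRoot_norm_leadingCoeff_mul_pow_le (by rw [hnat m]; exact hn) α
  refine ⟨a, ha, ?_⟩
  have heval : Tendsto (fun m => (p m).eval α) atTop (𝓝 0) := by
    rw [← hα.eq_zero]
    simp only [eval_eq_sum_range, hnat, hqnat]
    exact tendsto_finsetSum _ fun i _ => (hconv i).mul_const _
  have hlead : q.coeff n ≠ 0 := by
    rw [← hqnat, coeff_natDegree, leadingCoeff_ne_zero]
    rintro rfl
    simp at hq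
  have hlead' : ∀ m, 0 < ‖(p m).coeff n‖ := fun m => by
    rw [norm_pos_iff, ← hnat m, coeff_natDegree, leadingCoeff_ne_zero]
    intro h
    simpa [h] using hdeg m
  have hquot : Tendsto (fun m => ‖(p m).eval α‖ / ‖(p m).coeff n‖) atTop (𝓝 0) := by
    simpa [Pi.div_def] using heval.norm.div (hconv n).norm (norm_ne_zero_iff.mpr hlead)
  rw [Metric.tendsto_nhds]
  intro ε hε
  filter_upwards [hquot.eventually_lt_const (pow_pos hε n)] with m hm
  rw [dist_comm, dist_eq_norm]
  refine lt_of_pow_lt_pow_left₀ n hε.le (lt_of_le_of_lt ?_ hm)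
  rw [le_div_iff₀' (hlead' m)]
  simpa only [leadingCoeff, hnat] using hle m
end
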